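/- Let y be a nonnegative integer and suppose p = 4y^2 + 3y + 1 is a prime with p ≥ 5. Then there does not exist a nontrivial regular (8p^3, 4p^2−2p−4y−2, 2p−8y−6, 2p−2)-partial difference set in any Abelian group of order 8p^3. -/

import Mathlib

variable {G : Type*} [CommGroup G] [DecidableEq G] [Fintype G]

/-- The number of representations of `g` as `d₁ * d₂⁻¹` with `d₁, d₂ ∈ D`, `d₁ ≠ d₂`. -/
def pdsReps (D : Finset G) (g : G) : ℕ :=
  ((D ×ˢ D).filter (fun x => x.1 ≠ x.2 ∧ x.1 * x.2⁻¹ = g)).card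

/-- `D` is a `(v,k,λ,μ)`-partial difference set in `G`. -/
def IsPDS (D : Finset G) (v k l m : ℕ) : Prop :=
  Fintype.card G = v ∧ D.card = k ∧
  (∀ g : G, g ≠ 1 → g ∈ D → pdsReps D g = l) ∧
  (∀ g : G, g ≠ 1 → g ∉ D → pdsReps D g = m)

/-- `D` is regular: closed under inverses and not containing the identity. -/
def IsRegularPDS (D : Finset G) : Prop :=
  (∀ d ∈ D, d⁻¹ ∈ D) ∧ (1 : G) ∉ D

/-- A regular PDS is trivial if `D ∪ {e}` or `G \ D` is a subgroup. -/
def IsTrivialPDS (D : Finset G) : Prop :=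
  (∃ H : Subgroup G, (H : Set G) = ↑D ∪ {1}) ∨
  (∃ H : Subgroup G, (H : Set G) = (↑D : Set G)ᶜ)

open Finset MonoidAlgebra

section GroupRing

variable (R : Type*) [CommRing R]

/-- The element `∑ d ∈ D, d` of the group ring `R[G]`. -/
noncomputable def groupRingSum (D : Finset G) : MonoidAlgebra R G :=
  ∑ d ∈ D, single d 1

omit [CommGroup G] [Fintype G] in
theorem groupRingSum_apply (D : Finset G) (g : G) :
    (groupRingSum R D).coeff g = if g ∈ D then 1 else 0 := by
  simp [groupRingSum, Finsupp.single_apply]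

omit [DecidableEq G] in
theorem single_mul_groupRingSum_univ (d : G) :
    single d 1 * groupRingSum R (univ : Finset G) = groupRingSum R univ := by
  simp only [groupRingSum, mul_sum, single_mul_single, mul_one]
  exact Fintype.sum_equiv (Equiv.mulLeft d) _ _ fun _ => rfl

omit [DecidableEq G] in
theorem groupRingSum_mul_groupRingSum_univ (D : Finset G) :
    groupRingSum R D * groupRingSum R univ = (D.card : R) • groupRingSum R univ := by
  conv_lhs => enter [1]; rw [groupRingSum]
  simp only [sum_mul, single_mul_groupRingSum_univ, sum_const, Nat.cast_smul_eq_nsmul]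

omit [DecidableEq G] [Fintype G] in
theorem groupRingSum_inv {D : Finset G} (hD : ∀ d ∈ D, d⁻¹ ∈ D) :
    ∑ d ∈ D, single d⁻¹ 1 = groupRingSum R D :=
  sum_nbij' (·⁻¹) (·⁻¹) hD hD (by simp) (by simp) (by simp)

omit [Fintype G] in
theorem groupRingSum_sq_apply {D : Finset G} (hD : ∀ d ∈ D, d⁻¹ ∈ D) (g : G) :
    (groupRingSum R D * groupRingSum R D).coeff g =
      (((D ×ˢ D).filter fun x => x.1 * x.2⁻¹ = g).card : R) := by
  nth_rewrite 2 [← groupRingSum_inv R hD]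
  rw [groupRingSum, sum_mul_sum, ← sum_product']
  simp [Finsupp.single_apply, single_mul_single]

theorem IsPDS.groupRingSum_sq {D : Finset G} {v k l m : ℕ} (h : IsPDS D v k l m)
    (hD : IsRegularPDS D) :
    groupRingSum R D * groupRingSum R D =
      (k : R) • 1 + (l : R) • groupRingSum R D +
        (m : R) • (groupRingSum R univ - 1 - groupRingSum R D) := by
  obtain ⟨-, hk, hl, hm⟩ := h
  ext g
  have hreps : g ≠ 1 → ((D ×ˢ D).filter fun x => x.1 * x.2⁻¹ = g).card = pdsReps D g := by
    intro hg
    congr 1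
    refine filter_congr fun x _ => ⟨fun hx => ⟨fun h12 => hg ?_, hx⟩, And.right⟩
    rw [← hx, h12, mul_inv_cancel]
  rw [groupRingSum_sq_apply R hD.1]
  by_cases hg : g = 1
  · have hdiag : (D ×ˢ D).filter (fun x => x.1 * x.2⁻¹ = 1) = D.diag := by
      ext ⟨x, y⟩
      simp only [mem_filter, mem_product, mem_diag, mul_inv_eq_one]
      grind
    simp [hg, hdiag, hk, groupRingSum_apply, hD.2, one_def]
  · by_cases hgD : g ∈ D
    · simp [hreps hg, hl g hg hgD, groupRingSum_apply, hgD, one_def, Ne.symm hg]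
    · simp [hreps hg, hm g hg hgD, groupRingSum_apply, hgD, one_def, Ne.symm hg]

end GroupRing

/-- Every odd prime coprime to the group order and to the square root `w` of the quarter
discriminant is a multiplier. -/
theorem IsPDS.pow_prime_mem {D : Finset G} {v k l m a w q : ℕ} (h : IsPDS D v k l m)
    (hD : IsRegularPDS D) (hla : l + 2 * a = m) (hka : k + a ^ 2 = w ^ 2 + m)
    (hq : q.Prime) (hq2 : q ≠ 2) (hqv : q.Coprime v) (hqw : q.Coprime w) {d : G} (hd : d ∈ D) :
    d ^ q ∈ D := by
  have : Fact q.Prime := ⟨hq⟩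
  have hla' : (l : ZMod q) + 2 * a = m := by exact_mod_cast congrArg (Nat.cast : ℕ → ZMod q) hla
  have hka' : (k : ZMod q) + a ^ 2 = w ^ 2 + m := by
    exact_mod_cast congrArg (Nat.cast : ℕ → ZMod q) hka
  set R := ZMod q
  set S := groupRingSum R (univ : Finset G) with hS
  set T := groupRingSum R D with hT
  set E := T + (a : R) • 1 with hE
  have hE2 : E ^ 2 = ((w : R) ^ 2) • 1 + (m : R) • S := by
    have hT2 := h.groupRingSum_sq R hD
    have : E ^ 2 = T * T + (2 * a : R) • T + ((a : R) ^ 2) • 1 := by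
      rw [hE]; simp only [Algebra.smul_def, map_mul, map_pow, map_ofNat]; ring
    rw [this, hT2, ← hla', show (w : R) ^ 2 = k + a ^ 2 - (l + 2 * a) by rw [hla', hka']; ring]
    module
  have hTS : T * S = (k : R) • S := by rw [hT, hS, groupRingSum_mul_groupRingSum_univ, h.2.1]
  have hSS : S * S = (v : R) • S := by
    rw [hS, groupRingSum_mul_groupRingSum_univ, card_univ, h.1]
  have hES : E * S = (k + a : R) • S := by rw [hE, add_mul, hTS, smul_one_mul]; module
  have hodd (n : ℕ) : ∃ c : R, E ^ (2 * n + 1) = ((w : R) ^ (2 * n)) • E + c • S := by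
    induction n with
    | zero => exact ⟨0, by simp⟩
    | succ n ih =>
      obtain ⟨c, hc⟩ := ih
      refine ⟨w ^ (2 * n) * m * (k + a) + c * w ^ 2 + c * m * v, ?_⟩
      rw [show 2 * (n + 1) + 1 = (2 * n + 1) + 2 by ring, pow_add, hc, hE2, add_mul, mul_add,
        mul_add, smul_mul_smul_comm, smul_mul_smul_comm, smul_mul_smul_comm, smul_mul_smul_comm,
        hES, hSS, mul_one, mul_one]
      module
  have hES_pow (n : ℕ) : E ^ n * S = ((k + a : R) ^ n) • S := by
    induction n with
    | zero => simp
    | succ n ih => rw [pow_succ, mul_assoc, hES, mul_smul_comm, ih, smul_smul, pow_succ']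
  have hEq : E ^ q = E := by
    obtain ⟨n, hn⟩ := hq.odd_of_ne_two hq2
    obtain ⟨c, hc⟩ := hodd n
    have hw : (w : R) ^ (2 * n) = 1 := by
      rw [show 2 * n = q - 1 by omega]
      refine ZMod.pow_card_sub_one_eq_one ?_
      rw [Ne, ZMod.natCast_eq_zero_iff]
      exact (hq.coprime_iff_not_dvd).1 hqw
    rw [← hn, hw, one_smul] at hc
    have hv : (v : R) ≠ 0 := by
      rw [Ne, ZMod.natCast_eq_zero_iff]
      exact (hq.coprime_iff_not_dvd).1 hqv
    have h1 := hES_pow q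
    rw [hc, add_mul, hES, ZMod.pow_card, smul_mul_assoc, hSS, add_eq_left, smul_smul] at h1
    have h2 := congrArg (fun x => x.coeff 1) h1
    simp [hS, groupRingSum_apply, hv] at h2
    rw [hc, h2]; simp
  have hfrob : E ^ q = ∑ d ∈ D, single (d ^ q) 1 + (a : R) • 1 := by
    have : CharP (MonoidAlgebra R G) q := charP_of_injective_algebraMap
      (algebraMap R (MonoidAlgebra R G)).injective q
    rw [hE, add_pow_char, smul_pow, ZMod.pow_card, one_pow, hT, groupRingSum, sum_pow_char]
    simp [single_pow]
  rw [hEq, hE, add_left_inj] at hfrob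
  have hv := congrArg (fun x => x.coeff (d ^ q)) hfrob
  have hinj : Function.Injective fun g : G => g ^ q := by
    refine (Nat.Coprime.pow_left_bijective (n := q) ?_).1
    rw [Nat.card_eq_fintype_card, h.1]
    exact hqv.symm
  by_contra hdq
  rw [hT, groupRingSum_apply, if_neg hdq] at hv
  simp [Finsupp.single_apply, hinj.eq_iff, hd] at hv

/-- Every odd natural number coprime to `v` and `w` is a multiplier. -/
theorem IsPDS.pow_mem {D : Finset G} {v k l m a w : ℕ} (h : IsPDS D v k l m)
    (hD : IsRegularPDS D) (hla : l + 2 * a = m) (hka : k + a ^ 2 = w ^ 2 + m) {s : ℕ}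
    (hs2 : Odd s) (hsv : s.Coprime v) (hsw : s.Coprime w) {d : G} (hd : d ∈ D) :
    d ^ s ∈ D := by
  induction s using Nat.recOnMul generalizing d with
  | zero => simp at hs2
  | one => simpa
  | prime q hq =>
    exact h.pow_prime_mem hD hla hka hq (by rintro rfl; exact absurd hs2 (by decide)) hsv hsw hd
  | mul s t hs ht =>
    rw [pow_mul]
    rw [Nat.odd_mul] at hs2
    rw [Nat.coprime_mul_iff_left] at hsv hsw
    exact ht hs2.2 hsv.2 hsw.2 (hs hs2.1 hsv.1 hsw.1 hd)

theorem zpowers_eq_iff_exists_coprime {x z : G} :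
    Subgroup.zpowers z = Subgroup.zpowers x ↔
      ∃ s < orderOf x, (orderOf x).Coprime s ∧ x ^ s = z := by
  constructor
  · intro h
    have hz : z ∈ Subgroup.zpowers x := h ▸ Subgroup.mem_zpowers z
    obtain ⟨s, hs, rfl⟩ := mem_image.1 (mem_zpowers_iff_mem_range_orderOf.1 hz)
    refine ⟨s, mem_range.1 hs, ?_, rfl⟩
    have hord : orderOf (x ^ s) = orderOf x := by
      rw [← Nat.card_zpowers, h, Nat.card_zpowers]
    rw [orderOf_pow] at hord
    exact (Nat.div_eq_self.1 hord).resolve_left (orderOf_pos x).ne'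
  · rintro ⟨s, -, hs, rfl⟩
    refine Subgroup.eq_of_le_of_card_ge (Subgroup.zpowers_le.2 (Subgroup.npow_mem_zpowers x s)) ?_
    rw [Nat.card_zpowers, Nat.card_zpowers, hs.orderOf_pow]

theorem card_filter_zpowers_eq (x : G) [DecidablePred fun z : G =>
    Subgroup.zpowers z = Subgroup.zpowers x] :
    (univ.filter fun z : G => Subgroup.zpowers z = Subgroup.zpowers x).card =
      (orderOf x).totient := by
  have himage : (univ.filter fun z : G => Subgroup.zpowers z = Subgroup.zpowers x) =
      ((range (orderOf x)).filter fun s => (orderOf x).Coprime s).image (x ^ ·) := by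
    ext z
    simp [zpowers_eq_iff_exists_coprime, and_assoc]
  rw [himage, card_image_of_injOn, Nat.totient]
  exact pow_injOn_Iio_orderOf.mono fun s hs => by simp_all

theorem card_filter_pow_eight_le {p : ℕ} (hp : p.Prime) (hp2 : p ≠ 2)
    (hG : Fintype.card G = 8 * p ^ 3) : (univ.filter fun g : G => g ^ 8 = 1).card ≤ 8 := by
  have hmem (g : G) : g ∈ (powMonoidHom 8 : G →* G).ker ↔ g ^ 8 = 1 := by simp [MonoidHom.mem_ker]
  have : Fact (Nat.Prime 2) := ⟨Nat.prime_two⟩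
  have hgroup : IsPGroup 2 (powMonoidHom 8 : G →* G).ker := fun g =>
    ⟨3, Subtype.ext ((hmem g).1 g.2)⟩
  obtain ⟨n, hn⟩ := IsPGroup.iff_card.1 hgroup
  have hdvd : 2 ^ n ∣ 8 * p ^ 3 := by
    rw [← hn, ← hG, ← Nat.card_eq_fintype_card]
    exact Subgroup.card_subgroup_dvd_card _
  have hcop : (2 ^ n).Coprime (p ^ 3) :=
    ((Nat.coprime_primes Nat.prime_two hp).2 hp2.symm).pow n 3
  have hle := Nat.le_of_dvd (by norm_num) (hcop.dvd_of_dvd_mul_right hdvd)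
  rw [← hn, Nat.card_eq_fintype_card, Fintype.card_subtype] at hle
  simpa only [hmem] using hle

/-- In a group of order `8 * p ^ 3`, a set closed under powers prime to `2 * p` has, outside the
`8`-torsion, a number of elements divisible by `p - 1`. -/
theorem pred_dvd_card_filter_pow_eight_ne {p : ℕ} (hp : p.Prime)
    (hG : Fintype.card G = 8 * p ^ 3) {D : Finset G}
    (hD : ∀ s : ℕ, Odd s → s.Coprime p → ∀ d ∈ D, d ^ s ∈ D) :
    p - 1 ∣ (D.filter fun g => ¬ g ^ 8 = 1).card := by
  classical
  rw [card_eq_sum_card_image (fun z => Subgroup.zpowers z)]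
  refine dvd_sum fun H hH => ?_
  obtain ⟨x, hx, rfl⟩ := mem_image.1 hH
  obtain ⟨hxD, hx8⟩ := mem_filter.1 hx
  have hpx : p ∣ orderOf x := by
    by_contra hpx
    refine hx8 (orderOf_dvd_iff_pow_eq_one.1 ?_)
    have hcop : (orderOf x).Coprime (p ^ 3) := ((hp.coprime_iff_not_dvd.2 hpx).pow_left 3).symm
    exact hcop.dvd_of_dvd_mul_right (hG ▸ orderOf_dvd_card)
  have hclass : ((D.filter fun g => ¬ g ^ 8 = 1).filter fun z =>
      Subgroup.zpowers z = Subgroup.zpowers x) =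
      univ.filter fun z => Subgroup.zpowers z = Subgroup.zpowers x := by
    ext z
    simp only [mem_filter, mem_univ, true_and, and_iff_right_iff_imp]
    intro hz
    have hord : orderOf z = orderOf x := by rw [← Nat.card_zpowers, hz, Nat.card_zpowers]
    refine ⟨?_, by rwa [← orderOf_dvd_iff_pow_eq_one, hord, orderOf_dvd_iff_pow_eq_one]⟩
    obtain ⟨s, -, hs, rfl⟩ := zpowers_eq_iff_exists_coprime.1 hz
    rcases Nat.even_or_odd s with hs2 | hs2
    · have hx2 : Odd (orderOf x) := by
        rw [← Nat.coprime_two_right]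
        exact hs.coprime_dvd_right hs2.two_dvd
      have := hD (s + orderOf x) (hs2.add_odd hx2)
        (Nat.Coprime.coprime_dvd_right hpx (by simpa using hs.symm)) x hxD
      rwa [pow_add, pow_orderOf_eq_one, mul_one] at this
    · exact hD s hs2 (hs.symm.coprime_dvd_right hpx) x hxD
  rw [hclass, card_filter_zpowers_eq, ← Nat.totient_prime hp]
  exact Nat.totient_dvd_of_dvd hpx

/-- For `p = 4y^2+3y+1 ≥ 5` prime, there is no nontrivial regular
`(8p^3, 4p^2-2p-4y-2, 2p-8y-6, 2p-2)`-PDS in an Abelian group. -/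
theorem no_pds_case3i (y p : ℕ) (hpy : p = 4 * y ^ 2 + 3 * y + 1)
    (hp : p.Prime) (hp5 : 5 ≤ p)
    {G : Type*} [CommGroup G] [DecidableEq G] [Fintype G]
    (D : Finset G) :
    ¬ (IsPDS D (8 * p ^ 3) (4 * p ^ 2 - 2 * p - 4 * y - 2) (2 * p - 8 * y - 6)
          (2 * p - 2) ∧
        IsRegularPDS D ∧ ¬ IsTrivialPDS D) := by
  rintro ⟨h, hD, -⟩
  have hy : 2 ≤ y := by
    by_contra! hy
    interval_cases y
    · omega
    · subst hpy; revert hp; norm_num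
  have hp2 : p ≠ 2 := by omega
  have hk : 4 * y + 2 + 2 * p ≤ 4 * p ^ 2 := by nlinarith
  have hl : 8 * y + 6 ≤ 2 * p := by nlinarith
  have hmul (s : ℕ) (hs2 : Odd s) (hsp : s.Coprime p) : ∀ d ∈ D, d ^ s ∈ D := by
    have hs2' : s.Coprime 2 := Nat.coprime_two_right.2 hs2
    refine fun d hd => h.pow_mem (a := 4 * y + 2) (w := 2 * p) hD (by omega) ?_ hs2 ?_ ?_ hd
    · zify
      have hk' : ((4 * p ^ 2 - 2 * p - 4 * y - 2 : ℕ) : ℤ) = 4 * p ^ 2 - 2 * p - 4 * y - 2 := by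
        rw [Nat.sub_sub, Nat.sub_sub, Nat.cast_sub (by omega)]
        push_cast
        ring
      have hm' : ((2 * p - 2 : ℕ) : ℤ) = 2 * p - 2 := by omega
      have hpy' : (p : ℤ) = 4 * y ^ 2 + 3 * y + 1 := by exact_mod_cast hpy
      rw [hk', hm']
      linear_combination -4 * hpy'
    · exact (hs2'.pow_right 3).mul_right (hsp.pow_right 3)
    · exact hs2'.mul_right hsp
  obtain ⟨M, hM⟩ := pred_dvd_card_filter_pow_eight_ne hp h.1 hmul
  have hn : (D.filter fun g => g ^ 8 = 1).card ≤ 8 :=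
    (card_le_card (filter_subset_filter _ (subset_univ D))).trans
      (card_filter_pow_eight_le hp hp2 h.1)
  have hsplit := card_filter_add_card_filter_not (s := D) (fun g => g ^ 8 = 1)
  rw [h.2.1] at hsplit
  set n := (D.filter fun g => g ^ 8 = 1).card
  have hdvd : p - 1 ∣ n + 4 * y := by
    obtain ⟨r, rfl⟩ : ∃ r, p = r + 1 := ⟨p - 1, by omega⟩
    rw [Nat.add_sub_cancel] at hM ⊢
    rw [← Nat.dvd_add_left (Dvd.intro M rfl : r ∣ r * M)]
    refine ⟨4 * r + 6, ?_⟩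
    have : (r + 1) ^ 2 = r ^ 2 + 2 * r + 1 := by ring
    have : r * (4 * r + 6) = 4 * r ^ 2 + 6 * r := by ring
    omega
  have := Nat.le_of_dvd (by omega) hdvd
  have : 4 * y ^ 2 + 3 * y ≤ n + 4 * y := by omega
  nlinarith
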